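/- arXiv:1904.05622 — 5 statements merged into one kernel-verified Lean document; each statement's English description precedes it below -/
import Mathlib

section
/- For every index i with 2 ≤ i ≤ M, the sum of the negative eigenvalues below −ε of the constant-coefficient Neumann operator on the i-th subinterval satisfies the upper bound: Σ_{j≥1} Σ_{m≥1 with α_j(x_{i−1}) − p(x_{i−1})((m−1)π/δ)² > ε} (α_j(x_{i−1}) − p(x_{i−1})((m−1)π/δ)²) ≤ (1/δ)·Σ_{j with α_j(x_{i−1}) > ε} ∫_{x_{i−2}}^{x_{i−1}} β_j(ε,x) dx + Σ_{j with α_j(0) > ε} α_j(0). -/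
open scoped Classical

lemma aux_f_ge {ε A P δ t : ℝ} (hP : 0 < P) (hδ : 0 < δ) (hA : ε ≤ A) (ht : 0 ≤ t)
    (htB : t ≤ (δ / Real.pi) * Real.sqrt ((A - ε) / P)) :
    ε ≤ A - P * (Real.pi * t / δ) ^ 2 := by
  have hpi := Real.pi_pos
  have h1 : Real.pi * t / δ ≤ Real.sqrt ((A - ε) / P) := by
    rw [div_le_iff₀ hδ]
    calc Real.pi * t ≤ Real.pi * ((δ / Real.pi) * Real.sqrt ((A - ε) / P)) := by gcongr
      _ = _ := by field_simp
  have h0 : 0 ≤ Real.pi * t / δ := by positivity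
  have h2 : (Real.pi * t / δ) ^ 2 ≤ (A - ε) / P := by
    have h3 : 0 ≤ (A - ε) / P := div_nonneg (by linarith) hP.le
    calc (Real.pi * t / δ) ^ 2 ≤ (Real.sqrt ((A - ε) / P)) ^ 2 := by gcongr
      _ = _ := Real.sq_sqrt h3
  rw [le_div_iff₀ hP] at h2
  linarith

lemma aux_le_B {ε A P δ t : ℝ} (hP : 0 < P) (hδ : 0 < δ) (ht : 0 ≤ t)
    (h : ε < A - P * (Real.pi * t / δ) ^ 2) :
    t ≤ (δ / Real.pi) * Real.sqrt ((A - ε) / P) := by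
  have hpi := Real.pi_pos
  have h0 : 0 ≤ Real.pi * t / δ := by positivity
  have h1 : Real.pi * t / δ ≤ Real.sqrt ((A - ε) / P) := by
    apply Real.le_sqrt_of_sq_le
    rw [le_div_iff₀ hP]
    linarith
  calc t = (δ / Real.pi) * (Real.pi * t / δ) := by field_simp
    _ ≤ _ := by gcongr

lemma aux_int (A P δ u v : ℝ) :
    IntervalIntegrable (fun t => A - P * (Real.pi * t / δ) ^ 2) MeasureTheory.volume u v := by
  apply Continuous.intervalIntegrable
  fun_prop

lemma aux_mono_upper {ε A P δ u : ℝ} (hε : 0 < ε) (hP : 0 < P) (hδ : 0 < δ) (hA : ε ≤ A)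
    (hu : 0 ≤ u) (huB : u ≤ (δ / Real.pi) * Real.sqrt ((A - ε) / P)) :
    (∫ t in (0:ℝ)..u, (A - P * (Real.pi * t / δ) ^ 2)) ≤
      ∫ t in (0:ℝ)..((δ / Real.pi) * Real.sqrt ((A - ε) / P)),
        (A - P * (Real.pi * t / δ) ^ 2) := by
  rw [← intervalIntegral.integral_add_adjacent_intervals (aux_int A P δ 0 u)
    (aux_int A P δ u ((δ / Real.pi) * Real.sqrt ((A - ε) / P)))]
  have : 0 ≤ ∫ t in u..((δ / Real.pi) * Real.sqrt ((A - ε) / P)),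
        (A - P * (Real.pi * t / δ) ^ 2) := by
    apply intervalIntegral.integral_nonneg huB
    intro t ht
    exact hε.le.trans (aux_f_ge hP hδ hA (hu.trans ht.1) ht.2)
  linarith

lemma aux_beta_mono {ε A P A' P' δ : ℝ} (hε : 0 < ε) (hP' : 0 < P') (hPP : P' ≤ P)
    (hδ : 0 < δ) (hA : ε ≤ A) (hAA : A ≤ A') :
    (∫ t in (0:ℝ)..((δ / Real.pi) * Real.sqrt ((A - ε) / P)),
        (A - P * (Real.pi * t / δ) ^ 2)) ≤
      ∫ t in (0:ℝ)..((δ / Real.pi) * Real.sqrt ((A' - ε) / P')),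
        (A' - P' * (Real.pi * t / δ) ^ 2) := by
  have hpi := Real.pi_pos
  have hB : 0 ≤ (δ / Real.pi) * Real.sqrt ((A - ε) / P) := by positivity
  have hBB : (δ / Real.pi) * Real.sqrt ((A - ε) / P) ≤
      (δ / Real.pi) * Real.sqrt ((A' - ε) / P') := by
    have : (A - ε) / P ≤ (A' - ε) / P' := by
      apply div_le_div₀ <;> linarith
    gcongr
  refine le_trans ?_ (aux_mono_upper hε hP' hδ (hA.trans hAA) hB hBB)
  apply intervalIntegral.integral_mono_on hB (aux_int _ _ _ _ _) (aux_int _ _ _ _ _)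
  intro t _
  have : P' * (Real.pi * t / δ) ^ 2 ≤ P * (Real.pi * t / δ) ^ 2 := by gcongr
  linarith

lemma aux_sum {ε A P δ : ℝ} (hε : 0 < ε) (hP : 0 < P) (hδ : 0 < δ) (hA : ε ≤ A) :
    (∑' m : ℕ, if 1 ≤ m ∧ ε < A - P * (((m : ℝ) - 1) * Real.pi / δ) ^ 2
      then A - P * (((m : ℝ) - 1) * Real.pi / δ) ^ 2 else 0) ≤
    (∫ t in (0:ℝ)..((δ / Real.pi) * Real.sqrt ((A - ε) / P)),
        (A - P * (Real.pi * t / δ) ^ 2)) + A := by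
  have hpi := Real.pi_pos
  set B := (δ / Real.pi) * Real.sqrt ((A - ε) / P) with hBdef
  have hB : 0 ≤ B := by positivity
  set N := ⌊B⌋₊ with hN
  have hNB : (N : ℝ) ≤ B := Nat.floor_le hB
  rw [tsum_eq_sum (s := Finset.range (N + 2))]
  · rw [Finset.sum_range_succ']
    have hk : ∀ k ∈ Finset.range (N + 1),
        (if 1 ≤ k + 1 ∧ ε < A - P * ((((k + 1 : ℕ) : ℝ) - 1) * Real.pi / δ) ^ 2
          then A - P * ((((k + 1 : ℕ) : ℝ) - 1) * Real.pi / δ) ^ 2 else 0) ≤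
        A - P * (Real.pi * (k : ℝ) / δ) ^ 2 := by
      intro k hk
      have e : (((k + 1 : ℕ) : ℝ) - 1) * Real.pi / δ = Real.pi * k / δ := by
        push_cast; ring
      rw [e]
      split_ifs
      · exact le_rfl
      · have hkN : (k : ℝ) ≤ N := by
          have := Finset.mem_range.1 hk
          exact_mod_cast Nat.lt_succ_iff.1 this
        exact hε.le.trans (aux_f_ge hP hδ hA (Nat.cast_nonneg k) (hkN.trans hNB))
    have h1 := Finset.sum_le_sum hk
    rw [Finset.sum_range_succ' (fun k : ℕ => A - P * (Real.pi * (k : ℝ) / δ) ^ 2)] at h1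
    have h2 : AntitoneOn (fun t : ℝ => A - P * (Real.pi * t / δ) ^ 2)
        (Set.Icc (0:ℝ) (0 + (N : ℕ))) := by
      intro s hs t ht hst
      have hs0 := hs.1
      have : P * (Real.pi * s / δ) ^ 2 ≤ P * (Real.pi * t / δ) ^ 2 := by gcongr
      simp only
      linarith
    have h3 := h2.sum_le_integral
    simp only [zero_add] at h3
    have h4 := aux_mono_upper hε hP hδ hA (Nat.cast_nonneg N) hNB
    simp only [Nat.cast_zero, mul_zero, zero_div] at h1
    simp only [nonpos_iff_eq_zero, one_ne_zero, false_and, if_false]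
    norm_num at h1 h3 ⊢
    linarith
  · intro m hm
    apply if_neg
    rintro ⟨h1, h2⟩
    apply hm
    obtain ⟨k, rfl⟩ : ∃ k, m = k + 1 := ⟨m - 1, by omega⟩
    have e : (((k + 1 : ℕ) : ℝ) - 1) * Real.pi / δ = Real.pi * k / δ := by
      push_cast; ring
    rw [e] at h2
    have : k ≤ N := Nat.le_floor (aux_le_B hP hδ (Nat.cast_nonneg k) h2)
    simp only [Finset.mem_range]
    omega

/-- Upper bound (Theorem 2.3 of the paper) for the sum of the negative eigenvalues
below `−ε` of the constant-coefficient Neumann operator on the `i`-th subinterval: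
for `2 ≤ i ≤ M`,
`Σ_{j≥1} Σ_{m≥1, α_j(x_{i−1}) − p(x_{i−1})((m−1)π/δ)² > ε}
    (α_j(x_{i−1}) − p(x_{i−1})((m−1)π/δ)²)
  ≤ (1/δ)·Σ_{j, α_j(x_{i−1}) > ε} ∫_{x_{i−2}}^{x_{i−1}} β_j(ε,x) dx
    + Σ_{j, α_j(0) > ε} α_j(0)`. -/
theorem stmt_1
    (ε : ℝ) (hε : 0 < ε)
    (c₁ c₂ : ℝ) (hc₁ : 0 < c₁) (hc₂ : 0 < c₂)
    (p : ℝ → ℝ) (hp_mono : Monotone p)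
    (hp_bounds : ∀ x : ℝ, 0 ≤ x → c₁ ≤ p x ∧ p x ≤ c₂)
    (α : ℕ → ℝ → ℝ)
    (hα_pos : ∀ j, 1 ≤ j → ∀ x : ℝ, 0 ≤ x → 0 < α j x)
    (hα_cont : ∀ j, 1 ≤ j → ContinuousOn (α j) (Set.Ici 0))
    (hα_anti : ∀ j, 1 ≤ j → AntitoneOn (α j) (Set.Ici 0))
    (hα_lim : ∀ j, 1 ≤ j → Filter.Tendsto (α j) Filter.atTop (nhds 0))
    (hα_order : ∀ j, 1 ≤ j → ∀ x : ℝ, 0 ≤ x → α (j + 1) x ≤ α j x)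
    (hα0_lim : Filter.Tendsto (fun j => α j 0) Filter.atTop (nhds 0))
    (ψ : ℕ → ℝ) (hψ : ∀ j, 1 ≤ j → ψ j = sSup {x : ℝ | 0 ≤ x ∧ ε ≤ α j x})
    (a : ℝ) (ha : a ∈ Set.Ioo (0:ℝ) 1) (hψa : 2 ≤ (ψ 1) ^ a)
    (M : ℕ) (hM : (M : ℝ) = ⌊(ψ 1) ^ a⌋ + 1)
    (δ : ℝ) (hδ : δ = ψ 1 / M)
    (x : ℕ → ℝ) (hx : ∀ i : ℕ, x i = i * δ)
    (b : ℕ → ℝ → ℝ)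
    (hb : ∀ j y, b j y = (δ / Real.pi) * Real.sqrt ((α j y - ε) / p y))
    (β : ℕ → ℝ → ℝ)
    (hβ : ∀ j y, β j y =
      ∫ t in (0:ℝ)..(b j y), (α j y - p y * (Real.pi * t / δ) ^ 2))
    (i : ℕ) (hi : 2 ≤ i) (hiM : i ≤ M) :
    (∑' j : ℕ, ∑' m : ℕ,
        if 1 ≤ j ∧ 1 ≤ m ∧
            ε < α j (x (i - 1))
              - p (x (i - 1)) * (((m : ℝ) - 1) * Real.pi / δ) ^ 2
        then α j (x (i - 1))
              - p (x (i - 1)) * (((m : ℝ) - 1) * Real.pi / δ) ^ 2 else 0)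
      ≤ (1 / δ) * (∑' j : ℕ, if 1 ≤ j ∧ ε < α j (x (i - 1))
            then ∫ y in (x (i - 2))..(x (i - 1)), β j y else 0)
        + (∑' j : ℕ, if 1 ≤ j ∧ ε < α j 0 then α j 0 else 0) := by
  have ha0 : 0 < a := ha.1
  have hψ0 : 0 ≤ ψ 1 := by
    rw [hψ 1 le_rfl]
    exact Real.sSup_nonneg (fun y hy => hy.1)
  have hψpos : 0 < ψ 1 := by
    rcases hψ0.eq_or_lt with h | h
    · rw [← h, Real.zero_rpow ha0.ne'] at hψa
      norm_num at hψa
    · exact h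
  have hMpos : (0:ℝ) < M := by
    have : 0 < M := by omega
    exact_mod_cast this
  have hδ0 : 0 < δ := by rw [hδ]; positivity
  have hx0 : ∀ n, 0 ≤ x n := fun n => by rw [hx]; positivity
  have hxd : x (i - 1) - x (i - 2) = δ := by
    obtain ⟨k, rfl⟩ : ∃ k, i = k + 2 := ⟨i - 2, by omega⟩
    rw [hx, hx, show k + 2 - 1 = k + 1 by omega, show k + 2 - 2 = k by omega]
    push_cast; ring
  set X := x (i - 1) with hX
  set Y := x (i - 2) with hY
  have hY0 : 0 ≤ Y := hx0 _
  have hX0 : 0 ≤ X := hx0 _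
  have hYX : Y ≤ X := by linarith
  have hpp : ∀ y, 0 ≤ y → 0 < p y := fun y hy => hc₁.trans_le (hp_bounds y hy).1
  have hαX : ∀ j, 1 ≤ j → α j X ≤ α j 0 := fun j hj =>
    hα_anti j hj (Set.mem_Ici.2 le_rfl) (Set.mem_Ici.2 hX0) hX0
  -- monotonicity of β
  have hβmono : ∀ j, 1 ≤ j → ε < α j X → AntitoneOn (β j) (Set.Icc Y X) := by
    intro j hj hjX u hu v hv huv
    have hu0 := hY0.trans hu.1
    have hv0 := hY0.trans hv.1
    rw [hβ, hβ, hb, hb]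
    refine aux_beta_mono hε (hpp u hu0) (hp_mono huv) hδ0 ?_ (hα_anti j hj hu0 hv0 huv)
    exact hjX.le.trans (hα_anti j hj hv0 hX0 hv.2)
  have hβint : ∀ j, 1 ≤ j → ε < α j X → β j X ≤ (1 / δ) * ∫ y in Y..X, β j y := by
    intro j hj hjX
    have hm := hβmono j hj hjX
    have hi1 : IntervalIntegrable (β j) MeasureTheory.volume Y X := by
      apply AntitoneOn.intervalIntegrable
      rwa [Set.uIcc_of_le hYX]
    have h1 : (∫ _ in Y..X, β j X) ≤ ∫ y in Y..X, β j y :=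
      intervalIntegral.integral_mono_on hYX (by simp) hi1
        (fun y hy => hm hy ⟨hYX, le_rfl⟩ hy.2)
    rw [intervalIntegral.integral_const, hxd, smul_eq_mul] at h1
    rw [one_div, ← div_eq_inv_mul, le_div_iff₀ hδ0]
    linarith
  obtain ⟨J, hJ⟩ := Filter.eventually_atTop.1 (hα0_lim.eventually (gt_mem_nhds hε))
  have hbig : ∀ j, j ∉ Finset.range J → ¬ ε < α j 0 := by
    intro j hj
    have := hJ j (by simpa using hj)
    exact not_lt.2 this.le
  rw [tsum_eq_sum (s := Finset.range J), tsum_eq_sum (s := Finset.range J),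
    tsum_eq_sum (s := Finset.range J), Finset.mul_sum, ← Finset.sum_add_distrib]
  · apply Finset.sum_le_sum
    intro j _
    by_cases hj : 1 ≤ j
    · by_cases hjX : ε < α j X
      · have h0 := hjX.trans_le (hαX j hj)
        have h1 := aux_sum hε (hpp X hX0) hδ0 hjX.le
        have h2 := hβint j hj hjX
        rw [hβ, hb] at h2
        simp only [hj, hjX, h0, true_and, and_self, if_true]
        have h3 := hαX j hj
        linarith
      · have hz : ∀ m : ℕ, ¬ (ε < α j X - p X * (((m : ℝ) - 1) * Real.pi / δ) ^ 2) := by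
          intro m h
          have := mul_nonneg (hpp X hX0).le (sq_nonneg (((m : ℝ) - 1) * Real.pi / δ))
          linarith
        simp only [hz, hjX, and_false, if_false, tsum_zero, mul_zero, zero_add]
        split_ifs
        · exact (hα_pos j hj 0 le_rfl).le
        · exact le_rfl
    · simp [hj]
  · intro j hj
    exact if_neg (fun h => hbig j hj h.2)
  · intro j hj
    exact if_neg (fun h => hbig j hj (h.2.trans_le (hαX j h.1)))
  · intro j hj
    have : ∀ m : ℕ, ¬ (1 ≤ j ∧ 1 ≤ m ∧
        ε < α j X - p X * (((m : ℝ) - 1) * Real.pi / δ) ^ 2) := by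
      rintro m ⟨h1, _, h⟩
      have := mul_nonneg (hpp X hX0).le (sq_nonneg (((m : ℝ) - 1) * Real.pi / δ))
      exact hbig j hj (lt_of_lt_of_le (by linarith) (hαX j h1))
    simp only [this, if_false, tsum_zero]
end

section
/- With b = (δ/π)·√((α − ε)/p), the finite sum over integers m with 1 ≤ m ≤ ⌊b⌋ − 1 satisfies Σ_{m=1}^{⌊b⌋−1} (α − p(mπ/δ)²) > ∫_0^{b} (α − p(πt/δ)²) dt − 3α (the sum being interpreted as 0 when ⌊b⌋ − 1 < 1). -/
theorem aux_sum_s5 (α c : ℝ) (n : ℕ) :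
    ∑ m ∈ Finset.Icc (1:ℤ) (n:ℤ), (α - c * (m:ℝ) ^ 2)
      = α * n - c * (n * (n + 1) * (2 * n + 1) / 6) := by
  induction n with
  | zero => simp
  | succ k ih =>
    have h : Finset.Icc (1:ℤ) ((k + 1 : ℕ) : ℤ) = insert ((k:ℤ) + 1) (Finset.Icc (1:ℤ) (k:ℤ)) := by
      ext x
      simp only [Finset.mem_Icc, Finset.mem_insert]
      push_cast
      omega
    rw [h, Finset.sum_insert (by simp), ih]
    push_cast
    ring

theorem aux_int_s5 (α c b : ℝ) :
    ∫ t in (0:ℝ)..b, (α - c * t ^ 2) = α * b - c * (b ^ 3 / 3) := by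
  rw [intervalIntegral.integral_sub (by simp)
    ((by fun_prop : Continuous fun t : ℝ => c * t ^ 2).intervalIntegrable _ _)]
  simp
  norm_num
  ring

/-- With `b = (δ/π)·√((α − ε)/p)`, the finite sum over integers `m` with
`1 ≤ m ≤ ⌊b⌋ − 1` satisfies
`Σ_{m=1}^{⌊b⌋−1} (α − p(mπ/δ)²) > ∫_0^b (α − p(πt/δ)²) dt − 3α`
(the sum being interpreted as `0` when `⌊b⌋ − 1 < 1`). -/
theorem stmt_5 (δ p α ε : ℝ) (hδ : 0 < δ) (hp : 0 < p) (hα : ε < α) (hε : 0 < ε)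
    (b : ℝ) (hb : b = (δ / Real.pi) * Real.sqrt ((α - ε) / p)) :
    (∫ t in (0:ℝ)..b, (α - p * (Real.pi * t / δ) ^ 2)) - 3 * α
      < ∑ m ∈ Finset.Icc (1:ℤ) (⌊b⌋ - 1), (α - p * ((m:ℝ) * Real.pi / δ) ^ 2) := by
  have hπ := Real.pi_pos
  have hb0 : 0 ≤ b := by rw [hb]; positivity
  obtain ⟨c, hc⟩ : ∃ c : ℝ, c = p * (Real.pi / δ) ^ 2 := ⟨_, rfl⟩
  have hc0 : 0 < c := by rw [hc]; positivity
  have e1 : ∀ t : ℝ, α - p * (Real.pi * t / δ) ^ 2 = α - c * t ^ 2 := by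
    intro t; rw [hc]; ring
  have e2 : ∀ t : ℝ, α - p * (t * Real.pi / δ) ^ 2 = α - c * t ^ 2 := by
    intro t; rw [hc]; ring
  simp only [e1, e2]
  rw [aux_int_s5]
  have hα0 : 0 < α := hε.trans hα
  have h1 := Int.floor_le b
  have h2 := Int.lt_floor_add_one b
  have h3 : 0 ≤ ⌊b⌋ := Int.floor_nonneg.mpr hb0
  have hb3 : 0 ≤ c * (b ^ 3 / 3) := by positivity
  rcases h3.eq_or_lt with h | h
  · rw [← h] at h2 ⊢
    simp at h2 ⊢
    nlinarith
  · obtain ⟨n, hn⟩ := Int.eq_ofNat_of_zero_le (show 0 ≤ ⌊b⌋ - 1 by omega)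
    rw [hn, aux_sum_s5]
    have hf : ⌊b⌋ = (n:ℤ) + 1 := by omega
    rw [hf] at h1 h2
    push_cast at h1 h2
    have hn0 : (0:ℝ) ≤ n := Nat.cast_nonneg n
    have h5 : ((n:ℝ) + 1) ^ 3 ≤ b ^ 3 := by gcongr
    have h6 : (n:ℝ) * (n + 1) * (2 * n + 1) / 6 ≤ b ^ 3 / 3 := by nlinarith [mul_nonneg hn0 hn0]
    have h7 := mul_le_mul_of_nonneg_left h6 hc0.le
    have h8 := mul_lt_mul_of_pos_left h2 hα0
    linarith
end

section
/- For every integer i ≥ 1 one has δ_{i−1}/δ_i < 2·ψ^a. -/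
/-- Let `a ∈ (0,1)` and `ψ ≥ 1` with `ψ^a > 2`. Define `δ_0 = ψ/(⌊ψ^a⌋+1)` and
`δ_i = δ_{i−1}/(⌊δ_{i−1}·ψ^{(i+1)a−1}⌋+1)` for `i ≥ 1`. Then for every `i ≥ 1`
one has `δ_{i−1}/δ_i < 2·ψ^a`. -/
theorem stmt_7 (a ψ : ℝ) (ha : a ∈ Set.Ioo (0:ℝ) 1) (hψ : 1 ≤ ψ) (hψa : 2 < ψ ^ a)
    (δ : ℕ → ℝ)
    (h0 : δ 0 = ψ / ((⌊ψ ^ a⌋ : ℝ) + 1))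
    (hrec : ∀ i : ℕ, 1 ≤ i →
      δ i = δ (i - 1) / ((⌊δ (i - 1) * ψ ^ (((i : ℝ) + 1) * a - 1)⌋ : ℝ) + 1)) :
    ∀ i : ℕ, 1 ≤ i → δ (i - 1) / δ i < 2 * ψ ^ a := by
  have hp : 0 < ψ := by linarith
  have hx : ∀ x : ℝ, 0 < x → 0 < (⌊x⌋ : ℝ) + 1 := fun x h => h.trans (Int.lt_floor_add_one x)
  have key : ∀ n : ℕ, 0 < δ n ∧ δ n * ψ ^ (((n : ℝ) + 1) * a - 1) < 1 := by
    intro n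
    induction n with
    | zero =>
      have hf := hx (ψ ^ a) (by linarith)
      rw [h0]
      refine ⟨div_pos hp hf, ?_⟩
      have e : ψ * ψ ^ ((((0 : ℕ) : ℝ) + 1) * a - 1) = ψ ^ a := by
        rw [Real.rpow_sub hp, Real.rpow_one]
        simp
        field_simp
      rw [div_mul_eq_mul_div, e, div_lt_one hf]
      exact Int.lt_floor_add_one _
    | succ n ih =>
      have hr := hrec (n + 1) (by omega)
      rw [Nat.add_sub_cancel] at hr
      have hX : 0 < δ n * ψ ^ ((((n + 1 : ℕ) : ℝ) + 1) * a - 1) :=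
        mul_pos ih.1 (Real.rpow_pos_of_pos hp _)
      have hf := hx _ hX
      rw [hr]
      refine ⟨div_pos ih.1 hf, ?_⟩
      rw [div_mul_eq_mul_div, div_lt_one hf]
      exact Int.lt_floor_add_one _
  intro i hi
  obtain ⟨n, rfl⟩ : ∃ n, i = n + 1 := ⟨i - 1, by omega⟩
  have hr := hrec (n + 1) hi
  rw [Nat.add_sub_cancel] at hr ⊢
  obtain ⟨hd, hk⟩ := key n
  have hX : 0 < δ n * ψ ^ ((((n + 1 : ℕ) : ℝ) + 1) * a - 1) :=
    mul_pos hd (Real.rpow_pos_of_pos hp _)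
  have hf := hx _ hX
  rw [hr, div_div_cancel₀ hd.ne']
  have e : δ n * ψ ^ ((((n + 1 : ℕ) : ℝ) + 1) * a - 1)
      = δ n * ψ ^ (((n : ℝ) + 1) * a - 1) * ψ ^ a := by
    rw [mul_assoc, ← Real.rpow_add hp]
    congr 2
    push_cast
    ring
  have h1 := Int.floor_le (δ n * ψ ^ ((((n + 1 : ℕ) : ℝ) + 1) * a - 1))
  have h2 : δ n * ψ ^ (((n : ℝ) + 1) * a - 1) * ψ ^ a < 1 * ψ ^ a :=
    mul_lt_mul_of_pos_right hk (by linarith)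
  linarith
end

section
/- For every integer i ≥ 0 one has δ_i < ψ^{1−(i+1)a}; in particular, for every integer i₀ with i₀ ≥ 1/a − 2 one has δ_{i₀+1} ≤ 1. -/
/-- Let `a ∈ (0,1)` and `ψ ≥ 1` with `ψ^a > 2`. Define `δ_0 = ψ/(⌊ψ^a⌋+1)` and
`δ_i = δ_{i−1}/(⌊δ_{i−1}·ψ^{(i+1)a−1}⌋+1)` for `i ≥ 1`. Then for every `i ≥ 0`
one has `δ_i < ψ^{1−(i+1)a}`; in particular, for every `i₀` with `i₀ ≥ 1/a − 2`
one has `δ_{i₀+1} ≤ 1`. -/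
theorem stmt_8 (a ψ : ℝ) (ha : a ∈ Set.Ioo (0:ℝ) 1) (hψ : 1 ≤ ψ) (hψa : 2 < ψ ^ a)
    (δ : ℕ → ℝ)
    (h0 : δ 0 = ψ / ((⌊ψ ^ a⌋ : ℝ) + 1))
    (hrec : ∀ i : ℕ, 1 ≤ i →
      δ i = δ (i - 1) / ((⌊δ (i - 1) * ψ ^ (((i : ℝ) + 1) * a - 1)⌋ : ℝ) + 1)) :
    (∀ i : ℕ, δ i < ψ ^ (1 - ((i : ℝ) + 1) * a))
    ∧ (∀ i₀ : ℕ, 1 / a - 2 ≤ (i₀ : ℝ) → δ (i₀ + 1) ≤ 1) := by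
  obtain ⟨ha0, ha1⟩ := ha
  have hψ0 : 0 < ψ := by linarith
  have key : ∀ d p : ℝ, 0 < d → 0 < p →
      0 < d / ((⌊d * p⌋ : ℝ) + 1) ∧ d / ((⌊d * p⌋ : ℝ) + 1) < p⁻¹ := by
    intro d p hd hp
    have h1 : d * p < (⌊d * p⌋ : ℝ) + 1 := Int.lt_floor_add_one _
    have h2 : 0 < d * p := mul_pos hd hp
    have h3 : 0 < (⌊d * p⌋ : ℝ) + 1 := h2.trans h1
    refine ⟨div_pos hd h3, ?_⟩
    rw [div_lt_iff₀ h3, inv_mul_eq_div, lt_div_iff₀ hp]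
    exact h1
  have hall : ∀ i : ℕ, 0 < δ i ∧ δ i < ψ ^ (1 - ((i : ℝ) + 1) * a) := by
    intro i
    induction i with
    | zero =>
      have hp : 0 < ψ ^ (a - 1) := Real.rpow_pos_of_pos hψ0 _
      have h := key ψ (ψ ^ (a - 1)) hψ0 hp
      have e : ψ * ψ ^ (a - 1) = ψ ^ a := by
        rw [Real.rpow_sub_one hψ0.ne']
        field_simp
      rw [e, ← h0, ← Real.rpow_neg hψ0.le] at h
      have e2 : (1 - (((0 : ℕ) : ℝ) + 1) * a) = -(a - 1) := by push_cast; ring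
      rw [e2]
      exact h
    | succ n ih =>
      have hr := hrec (n + 1) (by omega)
      rw [Nat.add_sub_cancel] at hr
      have h := key (δ n) (ψ ^ ((((n + 1 : ℕ) : ℝ) + 1) * a - 1)) ih.1
        (Real.rpow_pos_of_pos hψ0 _)
      rw [← hr, ← Real.rpow_neg hψ0.le, neg_sub] at h
      exact h
  refine ⟨fun i => (hall i).2, fun i₀ hi => (hall (i₀ + 1)).2.le.trans ?_⟩
  apply Real.rpow_le_one_of_one_le_of_nonpos hψ
  have h : 1 / a ≤ (i₀ : ℝ) + 2 := by linarith
  rw [div_le_iff₀ ha0] at h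
  push_cast
  linarith
end

section
/- One has a ∈ (0,1) and t₀ > 0, and there exists ω > 0 such that for every η ∈ (0,ω): F₁(η) > t₀ and F₂(η) > t₀. -/
/-- Let `a₀ ∈ (0,2/3)` and `0 < m < (2−3a₀)²/(2a₀(4−3a₀))`. Set
`a = ((2−3a₀)² + 6a₀²m)/(4(2−3a₀))` and `t₀ = ((2−3a₀)² + 6a₀²m − 8a₀m)/(16a₀)`,
and for `η` define
`F₁(η) = −m − (1−a)(2−3a₀+3η)/(2(a₀−η)) − (3a₀+3η−2)/(2(a₀+η))` and
`F₂(η) = −(m(a₀−η)+a)/(a₀−η) − (3a₀+3η−2)/(2(a₀+η))`.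
Then `a ∈ (0,1)`, `t₀ > 0`, and there exists `ω > 0` such that for every
`η ∈ (0,ω)` one has `F₁(η) > t₀` and `F₂(η) > t₀`. -/
theorem stmt_16 (a₀ m : ℝ) (ha₀ : a₀ ∈ Set.Ioo (0:ℝ) (2/3))
    (hm : 0 < m) (hm' : m < (2 - 3 * a₀) ^ 2 / (2 * a₀ * (4 - 3 * a₀)))
    (a t₀ : ℝ)
    (ha : a = ((2 - 3 * a₀) ^ 2 + 6 * a₀ ^ 2 * m) / (4 * (2 - 3 * a₀)))
    (ht₀ : t₀ = ((2 - 3 * a₀) ^ 2 + 6 * a₀ ^ 2 * m - 8 * a₀ * m) / (16 * a₀))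
    (F₁ F₂ : ℝ → ℝ)
    (hF₁ : ∀ η : ℝ, F₁ η = -m - (1 - a) * (2 - 3 * a₀ + 3 * η) / (2 * (a₀ - η))
      - (3 * a₀ + 3 * η - 2) / (2 * (a₀ + η)))
    (hF₂ : ∀ η : ℝ, F₂ η = -(m * (a₀ - η) + a) / (a₀ - η)
      - (3 * a₀ + 3 * η - 2) / (2 * (a₀ + η))) :
    a ∈ Set.Ioo (0:ℝ) 1 ∧ 0 < t₀ ∧
      ∃ ω : ℝ, 0 < ω ∧ ∀ η : ℝ, 0 < η → η < ω → t₀ < F₁ η ∧ t₀ < F₂ η := by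
  obtain ⟨h0, h1⟩ := ha₀
  have hs : 0 < 2 - 3 * a₀ := by linarith
  have hD : 0 < 2 * a₀ * (4 - 3 * a₀) := by
    apply mul_pos <;> linarith
  rw [lt_div_iff₀ hD] at hm'
  have htpos : 0 < t₀ := by
    rw [ht₀]
    apply div_pos _ (by linarith)
    nlinarith
  have e1 : F₁ 0 = 2 * t₀ := by
    rw [hF₁, ht₀, ha]
    have := hs.ne'
    field_simp
    ring
  have e2 : F₂ 0 = 4 * t₀ / (2 - 3 * a₀) := by
    rw [hF₂, ht₀, ha]
    have := hs.ne'
    simp only [sub_zero, add_zero, mul_zero]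
    obtain ⟨s, hse⟩ : ∃ s, s = 2 - 3 * a₀ := ⟨_, rfl⟩
    rw [← hse] at this ⊢
    field_simp
    rw [hse]
    ring
  have c1 : ContinuousAt F₁ 0 := by
    rw [funext hF₁]
    have n1 : 2 * (a₀ - 0) ≠ 0 := by simp [h0.ne']
    have n2 : 2 * (a₀ + 0) ≠ 0 := by simp [h0.ne']
    fun_prop (disch := assumption)
  have c2 : ContinuousAt F₂ 0 := by
    rw [funext hF₂]
    have n1 : a₀ - 0 ≠ 0 := by simp [h0.ne']
    have n2 : 2 * (a₀ + 0) ≠ 0 := by simp [h0.ne']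
    fun_prop (disch := assumption)
  refine ⟨⟨?_, ?_⟩, htpos, ?_⟩
  · rw [ha]; positivity
  · rw [ha, div_lt_one (by linarith)]
    have k : 0 < 4 - 3 * a₀ := by linarith
    have k2 := mul_lt_mul_of_pos_left hm' (by linarith : 0 < 3 * a₀)
    have k3 : 0 < (2 - 3 * a₀) * 8 := by linarith
    by_contra hc
    push Not at hc
    have k4 := mul_le_mul_of_nonneg_left hc k.le
    nlinarith
  · have l1 : t₀ < F₁ 0 := by rw [e1]; linarith
    have l2 : t₀ < F₂ 0 := by
      rw [e2, lt_div_iff₀ hs]; nlinarith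
    have ev := (c1.eventually (lt_mem_nhds l1)).and (c2.eventually (lt_mem_nhds l2))
    obtain ⟨ω, hω, h⟩ := Metric.eventually_nhds_iff.1 ev
    refine ⟨ω, hω, fun η p q => h ?_⟩
    rw [Real.dist_eq, sub_zero, abs_of_pos p]
    exact q
end
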